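/- Let q be a real number with 0 < q < 1 and let m be a positive rational number. Then ∑_{i,j,k ≥ 0} q^{2m(i−j)² + (i+j)² + 2k² − 2(i+j)k − 2k} / ((q⁴;q⁴)_i (q⁴;q⁴)_j (q⁴;q⁴)_k) = 4 J_8² J̄_{8m, 16m+4} / J_4³ + 2 q^{2m−1} J_4³ J̄_{2, 16m+4} / (J_2² J_8²). -/

import Mathlib

open scoped BigOperators Topology Real

/-- Finite q-Pochhammer symbol `(a;q)_n = ∏_{k=0}^{n-1} (1 - a q^k)`. -/
noncomputable def qPochFinR (a q : ℝ) (n : ℕ) : ℝ := ∏ k ∈ Finset.range n, (1 - a * q ^ k)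

/-- Infinite q-Pochhammer symbol `(a;q)_∞ = ∏_{k=0}^{∞} (1 - a q^k)`. -/
noncomputable def qPochInfR (a q : ℝ) : ℝ := ∏' k : ℕ, (1 - a * q ^ k)

/-- `J_m = (q^m; q^m)_∞` with `q^m` the real power of `q`. -/
noncomputable def JR (q m : ℝ) : ℝ := qPochInfR (q ^ m) (q ^ m)

/-- `J_{a,m} = (q^a;q^m)_∞ (q^{m-a};q^m)_∞ (q^m;q^m)_∞` with real powers of `q`. -/
noncomputable def JamR (q a m : ℝ) : ℝ :=
  qPochInfR (q ^ a) (q ^ m) * qPochInfR (q ^ (m - a)) (q ^ m) * qPochInfR (q ^ m) (q ^ m)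

/-- `J̄_{a,m} = (-q^a;q^m)_∞ (-q^{m-a};q^m)_∞ (q^m;q^m)_∞` with real powers of `q`. -/
noncomputable def JbarR (q a m : ℝ) : ℝ :=
  qPochInfR (-(q ^ a)) (q ^ m) * qPochInfR (-(q ^ (m - a))) (q ^ m) * qPochInfR (q ^ m) (q ^ m)

theorem summable_norm_qPoch_factor (x : ℝ) {p : ℝ} (hp0 : 0 ≤ p) (hp1 : p < 1) :
    Summable fun k : ℕ => ‖-(x * p ^ k)‖ := by
  simpa [abs_mul, abs_of_nonneg hp0] using (summable_geometric_of_lt_one hp0 hp1).mul_left |x|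

theorem multipliable_qPoch_factor (x : ℝ) {p : ℝ} (hp0 : 0 ≤ p) (hp1 : p < 1) :
    Multipliable fun k : ℕ => 1 - x * p ^ k := by
  simpa [sub_eq_add_neg] using
    multipliable_one_add_of_summable (summable_norm_qPoch_factor x hp0 hp1)

theorem qPochFinR_succ (x p : ℝ) (n : ℕ) :
    qPochFinR x p (n + 1) = qPochFinR x p n * (1 - x * p ^ n) :=
  Finset.prod_range_succ _ _

theorem qPochFinR_self_pos {p : ℝ} (hp0 : 0 ≤ p) (hp1 : p < 1) (n : ℕ) :
    0 < qPochFinR p p n := by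
  refine Finset.prod_pos fun k _ => ?_
  have : p * p ^ k < 1 := by
    rw [← pow_succ']; exact pow_lt_one₀ hp0 hp1 (by simp)
  linarith

theorem qPochInfR_eq_mul_shift (x : ℝ) {p : ℝ} (hp0 : 0 ≤ p) (hp1 : p < 1) :
    qPochInfR x p = (1 - x) * qPochInfR (x * p) p := by
  have h := multipliable_qPoch_factor (x * p) hp0 hp1
  have e : ∀ k : ℕ, 1 - x * p * p ^ k = 1 - x * p ^ (k + 1) := fun k => by ring
  simp only [e] at h
  simp only [qPochInfR, e]
  simpa using tprod_eq_zero_mul' (f := fun k : ℕ => 1 - x * p ^ k) h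

theorem qPochInfR_eq_fin_mul (x : ℝ) {p : ℝ} (hp0 : 0 ≤ p) (hp1 : p < 1) (n : ℕ) :
    qPochInfR x p = qPochFinR x p n * qPochInfR (x * p ^ n) p := by
  induction n with
  | zero => simp [qPochFinR]
  | succ n ih =>
    rw [ih, qPochInfR_eq_mul_shift (x * p ^ n) hp0 hp1, qPochFinR_succ]
    ring_nf

theorem qPochInfR_self_ne_zero {p : ℝ} (hp0 : 0 ≤ p) (hp1 : p < 1) : qPochInfR p p ≠ 0 := by
  have := tprod_one_add_ne_zero_of_summable (f := fun k : ℕ => -(p * p ^ k)) (fun k => by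
    have : p * p ^ k < 1 := by
      rw [← pow_succ']; exact pow_lt_one₀ hp0 hp1 (by simp)
    intro h
    linarith) (summable_norm_qPoch_factor p hp0 hp1)
  simpa [qPochInfR, sub_eq_add_neg] using this

theorem summable_euler {p : ℝ} (hp0 : 0 < p) (hp1 : p < 1) (x : ℝ) :
    Summable fun n : ℕ => ‖p ^ n.choose 2 * x ^ n / qPochFinR p p n‖ := by
  have hlim : Filter.Tendsto (fun n : ℕ => p ^ n * |x| / (1 - p * p ^ n)) Filter.atTop (𝓝 0) := by
    have h := tendsto_pow_atTop_nhds_zero_of_lt_one hp0.le hp1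
    have := (h.mul_const |x|).div ((h.const_mul p).const_sub 1) (by simp)
    simpa [Pi.div_def] using this
  refine summable_of_ratio_norm_eventually_le (r := 1 / 2) (by norm_num) ?_
  filter_upwards [hlim.eventually_le_const (by norm_num : (0 : ℝ) < 1 / 2)] with n hn
  have hP := qPochFinR_self_pos hp0.le hp1 n
  have hP' := qPochFinR_self_pos hp0.le hp1 (n + 1)
  rw [qPochFinR_succ] at hP'
  have hf : 0 < 1 - p * p ^ n := pos_of_mul_pos_right hP' hP.le
  have key : p ^ (n + 1).choose 2 * x ^ (n + 1) / qPochFinR p p (n + 1)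
      = (p ^ n * x / (1 - p * p ^ n)) * (p ^ n.choose 2 * x ^ n / qPochFinR p p n) := by
    rw [qPochFinR_succ, Nat.choose_succ_succ' n 1, Nat.choose_one_right]
    field_simp
    ring
  rw [norm_norm, norm_norm, key, norm_mul]
  refine mul_le_mul_of_nonneg_right ?_ (norm_nonneg _)
  rw [norm_div, norm_mul, Real.norm_of_nonneg hf.le, Real.norm_of_nonneg (by positivity : 0 ≤ p ^ n)]
  exact hn

/-- Euler's expansion of `(-x; p)_∞`. -/
theorem hasSum_euler {p : ℝ} (hp0 : 0 < p) (hp1 : p < 1) (x : ℝ) :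
    HasSum (fun n : ℕ => p ^ n.choose 2 * x ^ n / qPochFinR p p n) (qPochInfR (-x) p) := by
  set F : ℝ → ℝ := fun y => ∑' n : ℕ, p ^ n.choose 2 * y ^ n / qPochFinR p p n with hF
  have hs (y : ℝ) : Summable fun n : ℕ => p ^ n.choose 2 * y ^ n / qPochFinR p p n :=
    (summable_euler hp0 hp1 y).of_norm
  have hfun (y : ℝ) : F y = (1 + y) * F (y * p) := by
    have h1 : F y - F (y * p) = y * F (y * p) := by
      simp only [hF]
      rw [← (hs y).tsum_sub (hs (y * p)), ((hs y).sub (hs (y * p))).tsum_eq_zero_add, ← tsum_mul_left]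
      simp only [pow_zero, sub_self, zero_add]
      refine tsum_congr fun n => ?_
      have hP := qPochFinR_self_pos hp0.le hp1 n
      have hP' := qPochFinR_self_pos hp0.le hp1 (n + 1)
      rw [qPochFinR_succ] at hP'
      have hf : 0 < 1 - p * p ^ n := pos_of_mul_pos_right hP' hP.le
      rw [qPochFinR_succ, Nat.choose_succ_succ' n 1, Nat.choose_one_right]
      field_simp
      ring
    linarith
  have hiter (n : ℕ) : F x = qPochFinR (-x) p n * F (x * p ^ n) := by
    induction n with
    | zero => simp [qPochFinR]
    | succ n ih =>
      rw [ih, hfun (x * p ^ n), qPochFinR_succ]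
      ring_nf
  have hpow := tendsto_pow_atTop_nhds_zero_of_lt_one hp0.le hp1
  have hlim : Filter.Tendsto (fun n : ℕ => F (x * p ^ n)) Filter.atTop (𝓝 1) := by
    have h1 : F 0 = 1 := by
      simp only [hF]
      rw [tsum_eq_single 0 (fun n hn => by simp [hn])]
      simp [qPochFinR]
    rw [← h1]
    refine tendsto_tsum_of_dominated_convergence (summable_euler hp0 hp1 x) (fun k => ?_)
      (Filter.Eventually.of_forall fun n k => ?_)
    · have := hpow.const_mul x
      rw [mul_zero] at this
      exact ((this.pow k).const_mul _).div_const _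
    · rw [norm_div, norm_div, norm_mul, norm_mul]
      gcongr ?_ * ?_ / ?_
      rw [norm_pow, norm_pow, norm_mul]
      gcongr
      rw [norm_pow, Real.norm_of_nonneg hp0.le]
      exact mul_le_of_le_one_right (norm_nonneg _) (pow_le_one₀ hp0.le hp1.le)
  have hprod : Filter.Tendsto (fun n : ℕ => qPochFinR (-x) p n) Filter.atTop
      (𝓝 (qPochInfR (-x) p)) :=
    (multipliable_qPoch_factor (-x) hp0.le hp1).hasProd.tendsto_prod_nat
  have := hprod.mul hlim
  simp only [← hiter, mul_one] at this
  rw [← tendsto_nhds_unique tendsto_const_nhds this]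
  exact (hs x).hasSum

theorem qPochInfR_neg_nonneg {p : ℝ} (hp0 : 0 < p) (hp1 : p < 1) {x : ℝ} (hx : 0 ≤ x) :
    0 ≤ qPochInfR (-x) p :=
  (hasSum_euler hp0 hp1 x).nonneg fun n => by
    have := qPochFinR_self_pos hp0.le hp1 n
    positivity

theorem sum_antidiagonal_qBinomial {p : ℝ} (hp0 : 0 < p) (hp1 : p < 1) (a b : ℝ) (N : ℕ) :
    ∑ nk ∈ Finset.HasAntidiagonal.antidiagonal N, (∏ k ∈ Finset.range nk.1, (a - b * p ^ k)) * b ^ nk.2 /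
      (qPochFinR p p nk.1 * qPochFinR p p nk.2) = a ^ N / qPochFinR p p N := by
  have hpos := qPochFinR_self_pos hp0.le hp1
  have hf (n : ℕ) : 0 < 1 - p * p ^ n := by
    have := hpos (n + 1)
    rw [qPochFinR_succ] at this
    exact pos_of_mul_pos_right this (hpos n).le
  induction N with
  | zero => simp [qPochFinR]
  | succ N ih =>
    refine mul_left_cancel₀ (hf N).ne' ?_
    set g : ℕ × ℕ → ℝ := fun nk => (∏ k ∈ Finset.range nk.1, (a - b * p ^ k)) * b ^ nk.2 /
      (qPochFinR p p nk.1 * qPochFinR p p nk.2) with hg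
    have h1 : ∑ nk ∈ Finset.HasAntidiagonal.antidiagonal (N + 1), (1 - p ^ nk.1) * g nk =
        ∑ nk ∈ Finset.HasAntidiagonal.antidiagonal N, (a - b * p ^ nk.1) * g nk := by
      rw [Finset.Nat.sum_antidiagonal_succ]
      simp only [pow_zero, sub_self, zero_mul, zero_add]
      refine Finset.sum_congr rfl fun nk _ => ?_
      simp only [hg, qPochFinR_succ, Finset.prod_range_succ, pow_succ' p nk.1]
      have h1 := hf nk.1
      have h2 := hpos nk.1
      have h3 := hpos nk.2
      generalize 1 - p * p ^ nk.1 = w at h1 ⊢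
      field_simp
    have h2 : ∑ nk ∈ Finset.HasAntidiagonal.antidiagonal (N + 1), p ^ nk.1 * (1 - p ^ nk.2) * g nk =
        ∑ nk ∈ Finset.HasAntidiagonal.antidiagonal N, (b * p ^ nk.1) * g nk := by
      rw [Finset.Nat.sum_antidiagonal_succ']
      simp only [pow_zero, sub_self, zero_mul, mul_zero, zero_add]
      refine Finset.sum_congr rfl fun nk _ => ?_
      simp only [hg, qPochFinR_succ]
      have := hf nk.2
      have := hpos nk.1
      have := hpos nk.2
      field_simp
      ring
    calc (1 - p * p ^ N) * ∑ nk ∈ Finset.HasAntidiagonal.antidiagonal (N + 1), g nk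
        = ∑ nk ∈ Finset.HasAntidiagonal.antidiagonal (N + 1), (1 - p ^ nk.1) * g nk +
          ∑ nk ∈ Finset.HasAntidiagonal.antidiagonal (N + 1), p ^ nk.1 * (1 - p ^ nk.2) * g nk := by
          rw [Finset.mul_sum, ← Finset.sum_add_distrib]
          refine Finset.sum_congr rfl fun nk hnk => ?_
          rw [← pow_succ', ← Finset.HasAntidiagonal.mem_antidiagonal.1 hnk, pow_add]
          ring
      _ = a * ∑ nk ∈ Finset.HasAntidiagonal.antidiagonal N, g nk := by
          rw [h1, h2, ← Finset.sum_add_distrib, Finset.mul_sum]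
          exact Finset.sum_congr rfl fun nk _ => by ring
      _ = _ := by
          rw [ih, qPochFinR_succ]
          have := hf N
          have := hpos N
          field_simp
          ring

theorem add_choose_two (a b : ℕ) :
    (a + b).choose 2 = a.choose 2 + b.choose 2 + a * b := by
  induction b with
  | zero => simp
  | succ b ih =>
    rw [← add_assoc, Nat.choose_succ_succ' (a + b) 1, Nat.choose_succ_succ' b 1, ih]
    simp only [Nat.choose_one_right]
    ring

/-- The `₁φ₁` summation in homogeneous form; `a = 0` gives Cauchy's identity. -/
theorem hasSum_one_phi_one {p : ℝ} (hp0 : 0 < p) (hp1 : p < 1) (a b : ℝ) :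
    HasSum (fun n : ℕ => (∏ k ∈ Finset.range n, (a - b * p ^ k)) * p ^ n.choose 2 *
      qPochInfR (-(b * p ^ n)) p / qPochFinR p p n) (qPochInfR (-a) p) := by
  have hpos := qPochFinR_self_pos hp0.le hp1
  set A : ℕ → ℝ := fun n => ∏ k ∈ Finset.range n, (a - b * p ^ k) with hA
  set u : ℕ × ℕ → ℝ := fun nk => A nk.1 * p ^ nk.1.choose 2 / qPochFinR p p nk.1 *
    (p ^ nk.2.choose 2 * (b * p ^ nk.1) ^ nk.2 / qPochFinR p p nk.2) with hu
  have hAle (n : ℕ) : |A n| ≤ (|a| + |b|) ^ n := by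
    rw [hA, Finset.abs_prod]
    calc _ ≤ ∏ _k ∈ Finset.range n, (|a| + |b|) := by
          refine Finset.prod_le_prod (fun _ _ => abs_nonneg _) fun k _ => ?_
          refine (abs_sub _ _).trans ?_
          rw [abs_mul, abs_of_nonneg (pow_nonneg hp0.le k)]
          gcongr
          exact mul_le_of_le_one_right (abs_nonneg _) (pow_le_one₀ hp0.le hp1.le)
      _ = _ := by simp
  have hsu : Summable u := by
    refine Summable.of_norm_bounded ((summable_euler hp0 hp1 (|a| + |b|)).mul_of_nonneg
      (summable_euler hp0 hp1 b) (fun _ => norm_nonneg _) fun _ => norm_nonneg _) fun nk => ?_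
    simp only [hu, norm_mul, norm_div, norm_pow, Real.norm_eq_abs]
    rw [mul_comm (|A _|)]
    have h1 : |a| + |b| = |(|a| + |b|)| := (abs_of_nonneg (by positivity)).symm
    rw [← h1]
    gcongr
    · exact hAle _
    · rw [abs_of_pos hp0]
      exact mul_le_of_le_one_right (abs_nonneg _) (pow_le_one₀ hp0.le hp1.le)
  have hfib (n : ℕ) : HasSum (fun k => u (n, k))
      (A n * p ^ n.choose 2 * qPochInfR (-(b * p ^ n)) p / qPochFinR p p n) := by
    have h := (hasSum_euler hp0 hp1 (b * p ^ n)).mul_left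
      (A n * p ^ n.choose 2 / qPochFinR p p n)
    rwa [div_mul_eq_mul_div] at h
  have htot : HasSum u (qPochInfR (-a) p) := by
    rw [← Finset.HasAntidiagonal.sigmaAntidiagonalEquivProd.hasSum_iff]
    refine HasSum.sigma_of_hasSum (hasSum_euler hp0 hp1 a) (fun N => ?_)
      (Finset.HasAntidiagonal.sigmaAntidiagonalEquivProd.summable_iff.2 hsu)
    have h : HasSum (fun c : Finset.HasAntidiagonal.antidiagonal N => u c)
        (∑ c ∈ Finset.HasAntidiagonal.antidiagonal N, u c) := Finset.hasSum _ _
    refine (congrArg (HasSum _) ?_).mp h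
    symm
    rw [mul_div_assoc, ← sum_antidiagonal_qBinomial hp0 hp1 a b N, Finset.mul_sum]
    refine Finset.sum_congr rfl fun nk hnk => ?_
    simp only [hu, hA]
    have hc : p ^ N.choose 2 = p ^ nk.1.choose 2 * p ^ nk.2.choose 2 * (p ^ nk.1) ^ nk.2 := by
      rw [← pow_mul, ← pow_add, ← pow_add, ← Finset.HasAntidiagonal.mem_antidiagonal.1 hnk, add_choose_two]
    rw [hc, mul_pow]
    ring
  exact htot.prod_fiberwise hfib

/-- Pairs of naturals, parametrised by their difference and their minimum. -/
def diagonalEquiv : ℤ × ℕ ≃ ℕ × ℕ where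
  toFun x := (x.2 + x.1.toNat, x.2 + (-x.1).toNat)
  invFun x := ((x.1 : ℤ) - x.2, min x.1 x.2)
  left_inv := by
    rintro ⟨d, l⟩
    ext <;> simp only [] <;> omega
  right_inv := by
    rintro ⟨i, j⟩
    ext <;> simp only [] <;> omega

theorem diagonalEquiv_apply (d : ℤ) (l : ℕ) :
    diagonalEquiv (d, l) = (l + d.toNat, l + (-d).toNat) := rfl

theorem toNat_mul_toNat_neg (d : ℤ) : d.toNat * (-d).toNat = 0 := by
  rw [mul_eq_zero]
  omega

theorem prod_mul_pow_range (c p : ℝ) (n : ℕ) :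
    ∏ k ∈ Finset.range n, c * p ^ k = c ^ n * p ^ n.choose 2 := by
  induction n with
  | zero => simp
  | succ n ih =>
    rw [Finset.prod_range_succ, ih, Nat.choose_succ_succ' n 1, Nat.choose_one_right]
    ring

theorem inv_qPochFinR_self {p : ℝ} (hp0 : 0 < p) (hp1 : p < 1) (n : ℕ) :
    (qPochFinR p p n)⁻¹ = qPochInfR (p ^ (n + 1)) p * (qPochInfR p p)⁻¹ := by
  have h := qPochInfR_eq_fin_mul p hp0.le hp1 n
  rw [← pow_succ'] at h
  have h0 := qPochInfR_self_ne_zero hp0.le hp1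
  refine inv_eq_of_mul_eq_one_right ?_
  rw [← mul_assoc, ← h, mul_inv_cancel₀ h0]

theorem two_mul_choose_two_add (l : ℕ) : 2 * l.choose 2 + l = l * l := by
  induction l with
  | zero => simp
  | succ l ih =>
    rw [Nat.choose_succ_succ' l 1, Nat.choose_one_right]
    linarith

theorem hasSum_cauchy {p : ℝ} (hp0 : 0 < p) (hp1 : p < 1) (e : ℕ) :
    HasSum (fun l : ℕ => p ^ (l * l + l * e) / (qPochFinR p p l * qPochFinR p p (l + e)))
      (qPochInfR p p)⁻¹ := by
  have h := (hasSum_one_phi_one hp0 hp1 0 (-p ^ (e + 1))).mul_right (qPochInfR p p)⁻¹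
  have hz : qPochInfR (-0) p = 1 := by simp [qPochInfR]
  rw [hz, one_mul] at h
  refine h.congr_fun fun l => ?_
  have h1 : p ^ (l * l + l * e) = (p ^ (e + 1)) ^ l * p ^ l.choose 2 * p ^ l.choose 2 := by
    rw [← pow_mul, ← pow_add, ← pow_add, ← two_mul_choose_two_add l]
    congr 1
    ring
  have h2 : ∏ k ∈ Finset.range l, (0 - -p ^ (e + 1) * p ^ k) =
      (p ^ (e + 1)) ^ l * p ^ l.choose 2 := by
    rw [← prod_mul_pow_range]
    exact Finset.prod_congr rfl fun k _ => by ring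
  rw [h1, h2, div_eq_mul_inv, mul_inv, inv_qPochFinR_self hp0 hp1 (l + e),
    show -(-p ^ (e + 1) * p ^ l) = p ^ (l + e + 1) by ring]
  ring

theorem qPochFinR_mul_of_mul_eq_zero (p : ℝ) (l : ℕ) {u v : ℕ} (h : u * v = 0) :
    qPochFinR p p (l + u) * qPochFinR p p (l + v) =
      qPochFinR p p l * qPochFinR p p (l + (u + v)) := by
  rcases mul_eq_zero.1 h with rfl | rfl
  · simp
  · simp [mul_comm]

theorem jacobi_fiber {p x y : ℝ} (hxy : x * y = p) (l : ℕ) {u v : ℕ} (h : u * v = 0) :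
    p ^ (l + u).choose 2 * x ^ (l + u) / qPochFinR p p (l + u) *
        (p ^ (l + v).choose 2 * y ^ (l + v) / qPochFinR p p (l + v)) =
      p ^ u.choose 2 * x ^ u * (p ^ v.choose 2 * y ^ v) *
        (p ^ (l * l + l * (u + v)) / (qPochFinR p p l * qPochFinR p p (l + (u + v)))) := by
  rw [← qPochFinR_mul_of_mul_eq_zero p l h, ← two_mul_choose_two_add l, add_choose_two,
    add_choose_two, show p ^ (2 * l.choose 2 + l + l * (u + v)) =
      p ^ l.choose 2 * p ^ l.choose 2 * (x ^ l * y ^ l) * p ^ (l * u) * p ^ (l * v) by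
        rw [← mul_pow x, hxy]; ring]
  simp only [pow_add]
  ring

/-- Jacobi's triple product identity. -/
theorem hasSum_jacobi {p : ℝ} (hp0 : 0 < p) (hp1 : p < 1) {x y : ℝ} (hxy : x * y = p) :
    HasSum (fun d : ℤ => p ^ d.toNat.choose 2 * x ^ d.toNat *
        (p ^ (-d).toNat.choose 2 * y ^ (-d).toNat))
      (qPochInfR (-x) p * qPochInfR (-y) p * qPochInfR p p) := by
  have hsum := summable_mul_of_summable_norm (summable_euler hp0 hp1 x) (summable_euler hp0 hp1 y)
  have hs := (hasSum_euler hp0 hp1 x).mul (hasSum_euler hp0 hp1 y) hsum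
  rw [← diagonalEquiv.hasSum_iff] at hs
  have h := (hs.prod_fiberwise fun d =>
    ((hasSum_cauchy hp0 hp1 (d.toNat + (-d).toNat)).mul_left
      (p ^ d.toNat.choose 2 * x ^ d.toNat * (p ^ (-d).toNat.choose 2 * y ^ (-d).toNat))).congr_fun
      fun l => jacobi_fiber hxy l (toNat_mul_toNat_neg d)).mul_right (qPochInfR p p)
  refine h.congr_fun fun d => ?_
  rw [inv_mul_cancel_right₀ (qPochInfR_self_ne_zero hp0.le hp1)]

theorem rpow_mul_cast_choose_two {q : ℝ} (hq0 : 0 < q) (M : ℝ) (n : ℕ) :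
    (q ^ M) ^ n.choose 2 = q ^ (M * ((n : ℝ) * ((n : ℝ) - 1) / 2)) := by
  rw [← Real.rpow_natCast, ← Real.rpow_mul hq0.le, Nat.cast_choose_two]

theorem hasSum_JbarR {q : ℝ} (hq0 : 0 < q) (hq1 : q < 1) (a : ℝ) {M : ℝ} (hM : 0 < M) :
    HasSum (fun d : ℤ => q ^ (M * ((d : ℝ) * ((d : ℝ) - 1) / 2) + a * d)) (JbarR q a M) := by
  have h := hasSum_jacobi (Real.rpow_pos_of_pos hq0 M) (Real.rpow_lt_one hq0.le hq1 hM)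
    (x := q ^ a) (y := q ^ (M - a)) (by rw [← Real.rpow_add hq0]; ring_nf)
  refine h.congr_fun fun d => ?_
  rw [rpow_mul_cast_choose_two hq0, rpow_mul_cast_choose_two hq0, ← Real.rpow_natCast,
    ← Real.rpow_natCast, ← Real.rpow_mul hq0.le, ← Real.rpow_mul hq0.le, ← Real.rpow_add hq0,
    ← Real.rpow_add hq0, ← Real.rpow_add hq0]
  congr 1
  obtain ⟨n, rfl | rfl⟩ := d.eq_nat_or_neg
  · simp
  · simp
    ring

theorem HasSum.int_even_add_odd {f : ℤ → ℝ} {a b : ℝ} (he : HasSum (fun k : ℤ => f (2 * k)) a)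
    (ho : HasSum (fun k : ℤ => f (2 * k + 1)) b) : HasSum f (a + b) := by
  have h2 : Function.Injective fun k : ℤ => 2 * k := fun _ _ h => by simpa using h
  have h3 : Function.Injective fun k : ℤ => 2 * k + 1 := fun _ _ h => by simpa using h
  have he' := h2.hasSum_range_iff.2 he
  have ho' := h3.hasSum_range_iff.2 ho
  refine he'.add_isCompl ?_ ho'
  have r2 : (Set.range fun k : ℤ => 2 * k) = {n | Even n} := by
    ext n
    simp [even_iff_exists_two_mul]
  have r3 : (Set.range fun k : ℤ => 2 * k + 1) = {n | Odd n} := by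
    ext n
    simp [Odd]
  rw [r2, r3]
  exact Int.isCompl_even_odd

theorem theta_diagonal {q : ℝ} (hq0 : 0 < q) (hq1 : q < 1) (e : ℝ) (l : ℕ) :
    q ^ ((2 * l + e) ^ 2) * qPochInfR (-(q ^ (-2 * (2 * l + e)))) (q ^ 4) =
      q ^ (e ^ 2) * ((∏ k ∈ Finset.range l, (q ^ (2 * e) - -(q ^ (4 * e + 4)) * (q ^ 4) ^ k)) *
        (q ^ 4) ^ l.choose 2) * qPochInfR (-(q ^ (-2 * e))) (q ^ 4) := by
  have hp0 : 0 ≤ q ^ 4 := by positivity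
  have hp1 : q ^ 4 < 1 := pow_lt_one₀ hq0.le hq1 (by norm_num)
  induction l with
  | zero => simp
  | succ l ih =>
    have h4 : q ^ 4 = q ^ (4 : ℝ) := by norm_cast
    have hs : -(q ^ (-2 * (2 * ((l + 1 : ℕ) : ℝ) + e))) * q ^ 4 = -(q ^ (-2 * (2 * (l : ℝ) + e))) := by
      rw [h4, neg_mul, ← Real.rpow_add hq0]
      push_cast
      ring_nf
    have hl : (q ^ 4) ^ l = q ^ (4 * (l : ℝ)) := by
      rw [h4, ← Real.rpow_natCast, ← Real.rpow_mul hq0.le]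
    have hexp : q ^ ((2 * ((l + 1 : ℕ) : ℝ) + e) ^ 2) * (1 + q ^ (-2 * (2 * ((l + 1 : ℕ) : ℝ) + e))) =
        q ^ ((2 * (l : ℝ) + e) ^ 2) *
          ((q ^ (2 * e) - -(q ^ (4 * e + 4)) * (q ^ 4) ^ l) * (q ^ 4) ^ l) := by
      rw [hl]
      simp only [neg_mul, sub_neg_eq_add, mul_add, add_mul, mul_one, ← Real.rpow_add hq0]
      push_cast
      ring_nf
    rw [qPochInfR_eq_mul_shift _ hp0 hp1, hs, sub_neg_eq_add, ← mul_assoc, hexp,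
      Finset.prod_range_succ, Nat.choose_succ_succ' l 1, Nat.choose_one_right, pow_add]
    linear_combination ((q ^ (2 * e) - -(q ^ (4 * e + 4)) * (q ^ 4) ^ l) * (q ^ 4) ^ l) * ih

/-- The weight of the sum over `(i, j)` that remains after summing over `k`. -/
noncomputable def pairWeight (q c : ℝ) (x : ℕ × ℕ) : ℝ :=
  q ^ (c * ((x.1 : ℝ) - x.2) ^ 2) *
    (q ^ (((x.1 : ℝ) + x.2) ^ 2) * qPochInfR (-(q ^ (-2 * ((x.1 : ℝ) + x.2)))) (q ^ 4)) /
      (qPochFinR (q ^ 4) (q ^ 4) x.1 * qPochFinR (q ^ 4) (q ^ 4) x.2)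

/-- The sum of `pairWeight` over the pairs with difference `e`. -/
noncomputable def diagonalWeight (q c e : ℝ) : ℝ :=
  q ^ ((c + 1) * e ^ 2) * (qPochInfR (-(q ^ (2 * e))) (q ^ 4) *
    qPochInfR (-(q ^ (-2 * e))) (q ^ 4)) / qPochInfR (q ^ 4) (q ^ 4)

theorem diagonalWeight_neg (q c e : ℝ) : diagonalWeight q c (-e) = diagonalWeight q c e := by
  simp only [diagonalWeight, neg_sq, mul_neg, neg_mul, neg_neg]
  ring

theorem hasSum_pairWeight_diagonal {q : ℝ} (hq0 : 0 < q) (hq1 : q < 1) (c : ℝ) (d : ℤ) :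
    HasSum (fun l : ℕ => pairWeight q c (diagonalEquiv (d, l))) (diagonalWeight q c d) := by
  have hp0 : 0 < q ^ 4 := by positivity
  have hp1 : q ^ 4 < 1 := pow_lt_one₀ hq0.le hq1 (by norm_num)
  set u := d.toNat with hu
  set v := (-d).toNat with hv
  have huv : u * v = 0 := toNat_mul_toNat_neg d
  have hd : (d : ℝ) = u - v := by
    have : d = u - v := by omega
    exact_mod_cast this
  have hE : diagonalWeight q c d = diagonalWeight q c ((u + v : ℕ) : ℝ) := by
    rw [hd]
    rcases mul_eq_zero.1 huv with h | h
    · rw [h, ← diagonalWeight_neg]; simp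
    · rw [h]; simp
  have hsq : (d : ℝ) ^ 2 = ((u + v : ℕ) : ℝ) ^ 2 := by
    have : (u : ℝ) * v = 0 := by exact_mod_cast huv
    rw [hd]
    push_cast
    linear_combination -4 * this
  set e := u + v with he
  have h := ((hasSum_one_phi_one hp0 hp1 (q ^ (2 * (e : ℝ))) (-(q ^ (4 * (e : ℝ) + 4)))).mul_right
    (q ^ (c * (e : ℝ) ^ 2) * q ^ ((e : ℝ) ^ 2) * qPochInfR (-(q ^ (-2 * (e : ℝ)))) (q ^ 4) *
      (qPochInfR (q ^ 4) (q ^ 4))⁻¹))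
  rw [hE]
  have hval : diagonalWeight q c e = qPochInfR (-(q ^ (2 * (e : ℝ)))) (q ^ 4) *
    (q ^ (c * (e : ℝ) ^ 2) * q ^ ((e : ℝ) ^ 2) * qPochInfR (-(q ^ (-2 * (e : ℝ)))) (q ^ 4) *
      (qPochInfR (q ^ 4) (q ^ 4))⁻¹) := by
    rw [diagonalWeight, add_mul, one_mul, Real.rpow_add hq0]
    ring
  rw [hval]
  refine h.congr_fun fun l => ?_
  have hadd : ((l + u : ℕ) : ℝ) + ((l + v : ℕ) : ℝ) = 2 * l + e := by
    rw [he]; push_cast; ring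
  have hsub : (((l + u : ℕ) : ℝ) - ((l + v : ℕ) : ℝ)) = d := by
    rw [hd]; push_cast; ring
  have hb : -(-(q ^ (4 * (e : ℝ) + 4)) * (q ^ 4) ^ l) = (q ^ 4) ^ (l + e + 1) := by
    rw [show q ^ (4 * (e : ℝ) + 4) = q ^ (4 * e + 4) by norm_cast]
    ring
  rw [diagonalEquiv_apply, ← hu, ← hv, pairWeight]
  simp only []
  rw [hadd, hsub, hsq, qPochFinR_mul_of_mul_eq_zero _ l huv, theta_diagonal hq0 hq1, hb,
    div_eq_mul_inv, mul_inv, inv_qPochFinR_self hp0 hp1 (l + (u + v)), ← he]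
  ring

/-- A normalised theta function of period `4`. -/
noncomputable def thetaRatio (q e : ℝ) : ℝ :=
  q ^ (e ^ 2 / 8) * (qPochInfR (-(q ^ e)) (q ^ 4) * qPochInfR (-(q ^ (-e))) (q ^ 4)) /
    (q ^ (e / 2) + q ^ (-(e / 2)))

theorem thetaRatio_periodic {q : ℝ} (hq0 : 0 < q) (hq1 : q < 1) :
    Function.Periodic (thetaRatio q) 4 := by
  intro e
  have hp0 : 0 ≤ q ^ 4 := by positivity
  have hp1 : q ^ 4 < 1 := pow_lt_one₀ hq0.le hq1 (by norm_num)
  have h4 : q ^ 4 = q ^ (4 : ℝ) := by norm_cast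
  have h1 : qPochInfR (-(q ^ e)) (q ^ 4) = (1 + q ^ e) * qPochInfR (-(q ^ (e + 4))) (q ^ 4) := by
    rw [qPochInfR_eq_mul_shift _ hp0 hp1, neg_mul, sub_neg_eq_add, Real.rpow_add hq0, ← h4]
  have h2 : qPochInfR (-(q ^ (-(e + 4)))) (q ^ 4) =
      (1 + q ^ (-(e + 4))) * qPochInfR (-(q ^ (-e))) (q ^ 4) := by
    rw [qPochInfR_eq_mul_shift _ hp0 hp1, neg_mul, sub_neg_eq_add, h4, ← Real.rpow_add hq0]
    ring_nf
  have hpos (x : ℝ) : 0 < q ^ x := Real.rpow_pos_of_pos hq0 x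
  rw [thetaRatio, thetaRatio, div_eq_div_iff (add_pos (hpos _) (hpos _)).ne'
    (add_pos (hpos _) (hpos _)).ne', h1, h2]
  have key : q ^ ((e + 4) ^ 2 / 8) * (1 + q ^ (-(e + 4))) * (q ^ (e / 2) + q ^ (-(e / 2))) =
      q ^ (e ^ 2 / 8) * (1 + q ^ e) * (q ^ ((e + 4) / 2) + q ^ (-((e + 4) / 2))) := by
    simp only [mul_add, add_mul, mul_one, ← Real.rpow_add hq0]
    ring_nf
  linear_combination (qPochInfR (-(q ^ (e + 4))) (q ^ 4) * qPochInfR (-(q ^ (-e))) (q ^ 4)) * key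

theorem diagonalWeight_eq {q : ℝ} (hq0 : 0 < q) (c e : ℝ) :
    diagonalWeight q c e = (q ^ ((c + 1 / 2) * e ^ 2 + e) + q ^ ((c + 1 / 2) * e ^ 2 - e)) *
      (thetaRatio q (2 * e) / qPochInfR (q ^ 4) (q ^ 4)) := by
  have hpos (x : ℝ) : 0 < q ^ x := Real.rpow_pos_of_pos hq0 x
  have h0 := (add_pos (hpos e) (hpos (-e))).ne'
  have h1 : q ^ ((c + 1) * e ^ 2) = q ^ ((c + 1 / 2) * e ^ 2) * q ^ ((2 * e) ^ 2 / 8) := by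
    rw [← Real.rpow_add hq0]; ring_nf
  rw [diagonalWeight, thetaRatio, h1, show 2 * e / 2 = e by ring, show -(2 * e) = -2 * e by ring,
    Real.rpow_add hq0, sub_eq_add_neg, Real.rpow_add hq0, ← mul_add]
  field_simp

theorem hasSum_diagonalWeight {q : ℝ} (hq0 : 0 < q) (hq1 : q < 1) {c : ℝ} (hc : 0 < c) :
    HasSum (fun d : ℤ => diagonalWeight q c d)
      (2 * JbarR q (4 * c) (8 * c + 4) * (thetaRatio q 0 / qPochInfR (q ^ 4) (q ^ 4)) +
        2 * q ^ (c - 1 / 2) * JbarR q 2 (8 * c + 4) *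
          (thetaRatio q 2 / qPochInfR (q ^ 4) (q ^ 4))) := by
  have hper := thetaRatio_periodic hq0 hq1
  refine HasSum.int_even_add_odd ?_ ?_
  · have h := hasSum_JbarR hq0 hq1 (4 * c) (M := 8 * c + 4) (by positivity)
    have h' := (Equiv.neg ℤ).hasSum_iff.2 h
    have := (h'.add h).mul_right (thetaRatio q 0 / qPochInfR (q ^ 4) (q ^ 4))
    rw [← two_mul] at this
    refine this.congr_fun fun s => ?_
    have hT : thetaRatio q (2 * ((2 * s : ℤ) : ℝ)) = thetaRatio q 0 := by
      have := hper.int_mul s 0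
      rw [← this]
      congr 1
      push_cast
      ring
    rw [diagonalWeight_eq hq0, hT]
    simp only [Function.comp_apply, Equiv.neg_apply]
    push_cast
    ring_nf
  · have h := hasSum_JbarR hq0 hq1 2 (M := 8 * c + 4) (by positivity)
    have h1 := (Equiv.neg ℤ).hasSum_iff.2 h
    have h2 := (Equiv.addRight (1 : ℤ)).hasSum_iff.2 h
    have := ((h2.add h1).mul_left (q ^ (c - 1 / 2))).mul_right
      (thetaRatio q 2 / qPochInfR (q ^ 4) (q ^ 4))
    rw [← two_mul, ← mul_assoc, mul_comm (q ^ (c - 1 / 2)) 2] at this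
    refine this.congr_fun fun s => ?_
    have hT : thetaRatio q (2 * ((2 * s + 1 : ℤ) : ℝ)) = thetaRatio q 2 := by
      have := hper.int_mul s 2
      rw [← this]
      congr 1
      push_cast
      ring
    rw [diagonalWeight_eq hq0, hT, mul_add]
    simp only [Function.comp_apply, Equiv.neg_apply, Equiv.coe_addRight, ← Real.rpow_add hq0]
    push_cast
    ring_nf

theorem pairWeight_nonneg {q : ℝ} (hq0 : 0 < q) (hq1 : q < 1) (c : ℝ) (x : ℕ × ℕ) :
    0 ≤ pairWeight q c x := by
  have hp0 : 0 < q ^ 4 := by positivity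
  have hp1 : q ^ 4 < 1 := pow_lt_one₀ hq0.le hq1 (by norm_num)
  have h1 := qPochFinR_self_pos hp0.le hp1 x.1
  have h2 := qPochFinR_self_pos hp0.le hp1 x.2
  have h3 := qPochInfR_neg_nonneg hp0 hp1
    (Real.rpow_pos_of_pos hq0 (-2 * ((x.1 : ℝ) + x.2))).le
  unfold pairWeight
  positivity

theorem hasSum_pairWeight {q : ℝ} (hq0 : 0 < q) (hq1 : q < 1) (c : ℝ) {S : ℝ}
    (h : HasSum (fun d : ℤ => diagonalWeight q c d) S) : HasSum (pairWeight q c) S := by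
  have hfib := hasSum_pairWeight_diagonal hq0 hq1 c
  have hsum : Summable (pairWeight q c ∘ diagonalEquiv) := by
    refine (summable_prod_of_nonneg fun x => pairWeight_nonneg hq0 hq1 c _).2
      ⟨fun d => (hfib d).summable, ?_⟩
    exact (h.congr_fun fun d => (hfib d).tsum_eq).summable
  rw [← diagonalEquiv.hasSum_iff]
  have h' := hsum.hasSum
  rwa [(h'.prod_fiberwise hfib).unique h] at h'

theorem hasSum_inner {q : ℝ} (hq0 : 0 < q) (hq1 : q < 1) (c : ℝ) (i j : ℕ) :
    HasSum (fun k : ℕ => q ^ (c * ((i : ℝ) - (j : ℝ)) ^ 2 + ((i : ℝ) + (j : ℝ)) ^ 2 +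
        2 * (k : ℝ) ^ 2 - 2 * ((i : ℝ) + (j : ℝ)) * (k : ℝ) - 2 * (k : ℝ)) /
      (qPochFinR (q ^ 4) (q ^ 4) i * qPochFinR (q ^ 4) (q ^ 4) j * qPochFinR (q ^ 4) (q ^ 4) k))
      (pairWeight q c (i, j)) := by
  have hp0 : 0 < q ^ 4 := by positivity
  have hp1 : q ^ 4 < 1 := pow_lt_one₀ hq0.le hq1 (by norm_num)
  have h := (hasSum_euler hp0 hp1 (q ^ (-2 * ((i : ℝ) + j)))).mul_left
    (q ^ (c * ((i : ℝ) - j) ^ 2) * q ^ (((i : ℝ) + j) ^ 2) /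
      (qPochFinR (q ^ 4) (q ^ 4) i * qPochFinR (q ^ 4) (q ^ 4) j))
  rw [show pairWeight q c (i, j) = _ by rw [pairWeight, ← mul_assoc, mul_div_right_comm]]
  refine h.congr_fun fun k => ?_
  have hc : (q ^ 4) ^ k.choose 2 = q ^ ((4 : ℝ) * ((k : ℝ) * ((k : ℝ) - 1) / 2)) := by
    rw [← rpow_mul_cast_choose_two hq0]
    norm_cast
  have hexp : q ^ (c * ((i : ℝ) - (j : ℝ)) ^ 2 + ((i : ℝ) + (j : ℝ)) ^ 2 +
        2 * (k : ℝ) ^ 2 - 2 * ((i : ℝ) + (j : ℝ)) * (k : ℝ) - 2 * (k : ℝ)) =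
      q ^ (c * ((i : ℝ) - j) ^ 2) * q ^ (((i : ℝ) + j) ^ 2) *
        ((q ^ 4) ^ k.choose 2 * (q ^ (-2 * ((i : ℝ) + j))) ^ k) := by
    rw [hc, ← Real.rpow_natCast _ k, ← Real.rpow_mul hq0.le]
    simp only [← Real.rpow_add hq0]
    ring_nf
  rw [hexp, div_mul_div_comm]

theorem JR_eq_natPow {q : ℝ} (n : ℕ) : JR q n = qPochInfR (q ^ n) (q ^ n) := by
  rw [JR, Real.rpow_natCast]

theorem qPochInfR_mul_neg (x : ℝ) {p : ℝ} (hp0 : 0 ≤ p) (hp1 : p < 1) :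
    qPochInfR x p * qPochInfR (-x) p = qPochInfR (x ^ 2) (p ^ 2) := by
  rw [qPochInfR, qPochInfR, ← (multipliable_qPoch_factor x hp0 hp1).tprod_mul
    (multipliable_qPoch_factor (-x) hp0 hp1)]
  exact tprod_congr fun k => by ring

theorem qPochInfR_even_mul_odd (x : ℝ) {p : ℝ} (hp0 : 0 ≤ p) (hp1 : p < 1) :
    qPochInfR x (p ^ 2) * qPochInfR (x * p) (p ^ 2) = qPochInfR x p := by
  have h0 : 0 ≤ p ^ 2 := by positivity
  have h1 : p ^ 2 < 1 := pow_lt_one₀ hp0 hp1 (by norm_num)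
  have he := multipliable_qPoch_factor x h0 h1
  have ho := multipliable_qPoch_factor (x * p) h0 h1
  have e1 (k : ℕ) : 1 - x * (p ^ 2) ^ k = 1 - x * p ^ (2 * k) := by rw [pow_mul]
  have e2 (k : ℕ) : 1 - x * p * (p ^ 2) ^ k = 1 - x * p ^ (2 * k + 1) := by
    rw [← pow_mul]; ring
  simp only [e1] at he
  simp only [e2] at ho
  simp only [qPochInfR, e1, e2]
  exact tprod_even_mul_odd (f := fun k : ℕ => 1 - x * p ^ k) he ho

theorem thetaRatio_zero {q : ℝ} (hq0 : 0 < q) (hq1 : q < 1) :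
    thetaRatio q 0 = 2 * (JR q 8 / JR q 4) ^ 2 := by
  have hp0 : 0 < q ^ 4 := by positivity
  have hp1 : q ^ 4 < 1 := pow_lt_one₀ hq0.le hq1 (by norm_num)
  have h4 : JR q 4 = qPochInfR (q ^ 4) (q ^ 4) := mod_cast JR_eq_natPow 4
  have h8 : JR q 8 = qPochInfR (q ^ 8) (q ^ 8) := mod_cast JR_eq_natPow 8
  have h := qPochInfR_mul_neg (q ^ 4) hp0.le hp1
  rw [← pow_mul] at h
  have hne := qPochInfR_self_ne_zero hp0.le hp1
  have hs := qPochInfR_eq_mul_shift (-1) hp0.le hp1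
  rw [h8, h4, ← h, mul_div_cancel_left₀ _ hne, thetaRatio]
  simp only [neg_zero, Real.rpow_zero, zero_div, hs, neg_mul, one_mul]
  norm_num
  ring

theorem thetaRatio_two {q : ℝ} (hq0 : 0 < q) (hq1 : q < 1) :
    thetaRatio q 2 = q ^ (-(1 / 2) : ℝ) * (JR q 4 ^ 2 / (JR q 2 * JR q 8)) ^ 2 := by
  have hp0 : 0 < q ^ 4 := by positivity
  have hp1 : q ^ 4 < 1 := pow_lt_one₀ hq0.le hq1 (by norm_num)
  have hp0' : 0 < q ^ 2 := by positivity
  have hp1' : q ^ 2 < 1 := pow_lt_one₀ hq0.le hq1 (by norm_num)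
  have h2 : JR q 2 = qPochInfR (q ^ 2) (q ^ 2) := mod_cast JR_eq_natPow 2
  have h4 : JR q 4 = qPochInfR (q ^ 4) (q ^ 4) := mod_cast JR_eq_natPow 4
  have h8 : JR q 8 = qPochInfR (q ^ 8) (q ^ 8) := mod_cast JR_eq_natPow 8
  have n2 : JR q 2 ≠ 0 := h2 ▸ qPochInfR_self_ne_zero hp0'.le hp1'
  have n8 : JR q 8 ≠ 0 := h8 ▸ qPochInfR_self_ne_zero (by positivity)
    (pow_lt_one₀ hq0.le hq1 (by norm_num))
  have a := qPochInfR_mul_neg (q ^ 2) hp0.le hp1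
  have b := qPochInfR_even_mul_odd (q ^ 2) hp0'.le hp1'
  have d := qPochInfR_even_mul_odd (q ^ 4) hp0.le hp1
  simp only [← pow_mul, ← pow_add] at a b d
  norm_num at a b d
  rw [← h4, ← h2] at b
  rw [← h4, ← h8, ← a] at d
  have hneg : qPochInfR (-q ^ 2) (q ^ 4) = JR q 4 ^ 2 / (JR q 2 * JR q 8) := by
    rw [eq_div_iff (mul_ne_zero n2 n8), ← b]
    linear_combination JR q 4 * d
  have hs := qPochInfR_eq_mul_shift (-(q ^ (-2 : ℝ))) hp0.le hp1
  have e1 : -(q ^ (-2 : ℝ)) * q ^ 4 = -q ^ 2 := by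
    rw [show q ^ 4 = q ^ (4 : ℝ) by norm_cast, show q ^ 2 = q ^ (2 : ℝ) by norm_cast, neg_mul,
      ← Real.rpow_add hq0]
    norm_num
  rw [e1, hneg] at hs
  have e2 : q ^ (2 : ℝ) = q ^ 2 := by norm_cast
  have hpos (x : ℝ) : 0 < q ^ x := Real.rpow_pos_of_pos hq0 x
  rw [thetaRatio, hs, e2, hneg, div_eq_iff (add_pos (hpos _) (hpos _)).ne']
  have key : q ^ ((2 : ℝ) ^ 2 / 8) * (1 + q ^ (-2 : ℝ)) =
      q ^ (-(1 / 2) : ℝ) * (q ^ ((2 : ℝ) / 2) + q ^ (-((2 : ℝ) / 2))) := by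
    simp only [mul_add, mul_one, ← Real.rpow_add hq0]
    norm_num
  linear_combination (JR q 4 ^ 2 / (JR q 2 * JR q 8)) ^ 2 * key

theorem stmt3 (q : ℝ) (hq0 : 0 < q) (hq1 : q < 1) (m : ℚ) (hm : 0 < m) :
    (∑' (i : ℕ) (j : ℕ) (k : ℕ),
      q ^ (2*(m:ℝ)*((i:ℝ)-(j:ℝ))^2 + ((i:ℝ)+(j:ℝ))^2 + 2*(k:ℝ)^2
            - 2*((i:ℝ)+(j:ℝ))*(k:ℝ) - 2*(k:ℝ)) /
        (qPochFinR (q ^ (4:ℕ)) (q ^ (4:ℕ)) i * qPochFinR (q ^ (4:ℕ)) (q ^ (4:ℕ)) j *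
          qPochFinR (q ^ (4:ℕ)) (q ^ (4:ℕ)) k)) =
    4 * JR q 8 ^ 2 * JbarR q (8*(m:ℝ)) (16*(m:ℝ)+4) / JR q 4 ^ 3
    + 2 * q ^ (2*(m:ℝ)-1) * JR q 4 ^ 3 * JbarR q 2 (16*(m:ℝ)+4) /
        (JR q 2 ^ 2 * JR q 8 ^ 2) := by
  have hm' : (0 : ℝ) < m := by exact_mod_cast hm
  have hp0 : 0 < q ^ 4 := by positivity
  have hp1 : q ^ 4 < 1 := pow_lt_one₀ hq0.le hq1 (by norm_num)
  have h := hasSum_pairWeight hq0 hq1 (2 * (m : ℝ)) (hasSum_diagonalWeight hq0 hq1 (by positivity))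
  have hi (i j : ℕ) := (hasSum_inner hq0 hq1 (2 * (m : ℝ)) i j).tsum_eq
  simp only [hi]
  rw [← h.summable.tsum_prod, h.tsum_eq, thetaRatio_zero hq0 hq1, thetaRatio_two hq0 hq1]
  have h4 : JR q 4 = qPochInfR (q ^ 4) (q ^ 4) := mod_cast JR_eq_natPow 4
  have n4 : JR q 4 ≠ 0 := h4 ▸ qPochInfR_self_ne_zero hp0.le hp1
  have hexp : q ^ (2 * (m : ℝ) - 1) = q ^ (2 * (m : ℝ) - 1 / 2) * q ^ (-(1 / 2) : ℝ) := by
    rw [← Real.rpow_add hq0]; ring_nf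
  rw [← h4, hexp, show 4 * (2 * (m : ℝ)) = 8 * m by ring, show 8 * (2 * (m : ℝ)) = 16 * m by ring]
  congr 1
  · field_simp
    ring
  · field_simp
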